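/- Symmetry of the gauge-inverse relation. Let p, q ≥ 1, let F_1 ∈ ℂ((1/v)) be of the form F_1 = v^q·(1 + Σ_{n≥1} a_n v^{−n}), and let F_2 ∈ ℂ((1/w)) be of the form F_2 = w^p·(1 + Σ_{n≥1} â_n w^{−n}). Suppose there exist R ∈ v^{−p}·ℂ[[1/v]] and a series Y = v·(1 + Σ_{n≥1} y_n v^{−n}) with Y^q = F_1 + R and F_2∘Y = v^p. Then there exist R′ ∈ w^{−q}·ℂ[[1/w]] and a series Y′ = w·(1 + Σ_{n≥1} y′_n w^{−n}) with (Y′)^p = F_2 + R′ and F_1∘Y′ = w^q. -/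

import Mathlib

/- STATEMENT 13: symmetry of the gauge-inverse relation.  For
`F₁ = v^q(1 + ∑ a_n v^{-n})` and `F₂ = w^p(1 + ∑ â_n w^{-n})`: if some
`Y = v(1 + ∑ y_n v^{-n})` satisfies `Y^q = F₁ + R` with `R ∈ v^{-p}·ℂ[[1/v]]`
and `F₂∘Y = v^p`, then some `Y′ = w(1 + ∑ y′_n w^{-n})` satisfies
`(Y′)^p = F₂ + R′` with `R′ ∈ w^{-q}·ℂ[[1/w]]` and `F₁∘Y′ = w^q`.

`ℂ((1/v))` is encoded as `LaurentSeries ℂ` in `X = 1/v`; an element `F`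
represents `∑_m F.coeff m · v^{-m}`; `CompEq F g H` means `H = F∘g`. -/

open scoped Classical
noncomputable section

abbrev LS : Type := LaurentSeries ℂ

/-- The element `v = X⁻¹`. -/
def zz : LS := HahnSeries.single (-1 : ℤ) (1 : ℂ)

/-- `1 + ∑_{n≥1} c n X^n` as a power series. -/
def onePlusP (c : ℕ → ℂ) : PowerSeries ℂ := PowerSeries.mk fun n => if n = 0 then 1 else c n

/-- `1 + ∑_{n≥1} c n v^{-n}` as an element of `ℂ((1/v))`. -/
def onePlusL (c : ℕ → ℂ) : LS := HahnSeries.ofPowerSeries ℤ ℂ (onePlusP c)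

/-- `v·(1 + ∑_{n≥1} c n v^{-n})`. -/
def zSeries (c : ℕ → ℂ) : LS := zz * onePlusL c

/-- `H = F ∘ g`. -/
def CompEq (F g H : LS) : Prop :=
  ∀ k : ℤ, H.coeff k = ∑ᶠ m : ℤ, F.coeff m * (g ^ (-m)).coeff k

/-- `R ∈ v^{-p}·ℂ[[1/v]]`: in `X`-exponents, `R.coeff m = 0` for `m < p`. -/
def GaugeAt (p : ℕ) (R : LS) : Prop := ∀ m : ℤ, m < (p : ℤ) → R.coeff m = 0

open PowerSeries in
theorem coeff_subst_eq_sum_range {t : PowerSeries ℂ} (ht : constantCoeff t = 0)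
    (f : PowerSeries ℂ) {b j : ℕ} (hb : b ≤ j) :
    coeff b (f.subst t) = ∑ n ∈ Finset.range (j + 1), coeff n f * coeff b (t ^ n) := by
  rw [coeff_subst' (HasSubst.of_constantCoeff_zero' ht)]
  simp only [smul_eq_mul]
  refine finsum_eq_sum_of_support_subset _ fun n hn => ?_
  simp only [Finset.coe_range, Set.mem_Iio]
  by_contra! h
  obtain ⟨u, rfl⟩ := X_dvd_iff.mpr ht
  apply hn
  simp [mul_pow, coeff_X_pow_mul', show ¬ n ≤ b by omega]

open PowerSeries in
theorem coeff_mul_subst_eq_finsum {t : PowerSeries ℂ} (ht : constantCoeff t = 0)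
    (W f : PowerSeries ℂ) (j : ℕ) :
    coeff j (W * f.subst t) = ∑ᶠ n : ℕ, coeff n f * coeff j (W * t ^ n) := by
  rw [finsum_eq_sum_of_support_subset (s := Finset.range (j + 1))]
  · simp only [coeff_mul, Finset.mul_sum]
    rw [Finset.sum_comm]
    refine Finset.sum_congr rfl fun x hx => ?_
    rw [coeff_subst_eq_sum_range ht f (by have := Finset.HasAntidiagonal.mem_antidiagonal.mp hx; omega : x.2 ≤ j), Finset.mul_sum]
    exact Finset.sum_congr rfl fun n _ => by ring
  · intro n hn
    simp only [Finset.coe_range, Set.mem_Iio]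
    by_contra! h
    obtain ⟨u, rfl⟩ := X_dvd_iff.mpr ht
    apply hn
    simp only
    rw [mul_pow, mul_left_comm, coeff_X_pow_mul', if_neg (by omega), mul_zero]

open PowerSeries in
/-- If `a ≡ b` modulo `X ^ N`, then `f ∘ a ≡ f ∘ b` modulo `X ^ N`. -/
theorem X_pow_dvd_subst_sub_subst {a b : PowerSeries ℂ} (ha : constantCoeff a = 0)
    (hb : constantCoeff b = 0) (f : PowerSeries ℂ) {N : ℕ} (h : X ^ N ∣ a - b) :
    X ^ N ∣ f.subst a - f.subst b := by
  rw [X_pow_dvd_iff]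
  intro m hm
  rw [map_sub, coeff_subst_eq_sum_range ha f le_rfl, coeff_subst_eq_sum_range hb f le_rfl,
    ← Finset.sum_sub_distrib]
  refine Finset.sum_eq_zero fun n _ => ?_
  rw [← mul_sub, ← map_sub, X_pow_dvd_iff.mp (h.trans (sub_dvd_pow_sub_pow a b n)) m hm, mul_zero]

open PowerSeries in
/-- A power series with constant coefficient `1` has a `q`-th root with constant coefficient `1`. -/
theorem exists_pow_eq_of_constantCoeff_eq_one {A : PowerSeries ℂ} (hA : constantCoeff A = 1)
    {q : ℕ} (hq : q ≠ 0) : ∃ W : PowerSeries ℂ, constantCoeff W = 1 ∧ W ^ q = A := by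
  have hA' : constantCoeff (A - 1) = 0 := by simp [hA]
  have hs := HasSubst.of_constantCoeff_zero' hA'
  have hpow : ∀ n : ℕ, PowerSeries.binomialSeries ℂ ((q : ℂ)⁻¹) ^ n = PowerSeries.binomialSeries ℂ ((n : ℂ) * (q : ℂ)⁻¹) := by
    intro n
    induction n with
    | zero => simp
    | succ n ih => rw [pow_succ, ih, ← binomialSeries_add]; congr 1; push_cast; ring
  refine ⟨(PowerSeries.binomialSeries ℂ ((q : ℂ)⁻¹)).subst (A - 1), ?_, ?_⟩
  · rw [← coeff_zero_eq_constantCoeff_apply, coeff_subst_eq_sum_range hA' _ le_rfl]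
    simp
  · rw [← subst_pow hs, hpow, mul_inv_cancel₀ (by exact_mod_cast hq), ← Nat.cast_one (R := ℂ),
      binomialSeries_nat, pow_one, subst_add hs, subst_X hs, ← coe_substAlgHom hs, map_one]
    ring

open PowerSeries in
/-- If `W ^ q ≡ U ^ q` modulo `X ^ N` and both have constant coefficient `1`, then `W ≡ U`. -/
theorem X_pow_dvd_sub_of_dvd_pow_sub_pow {W U : PowerSeries ℂ} (hW : constantCoeff W = 1)
    (hU : constantCoeff U = 1) {q N : ℕ} (hq : q ≠ 0) (h : X ^ N ∣ W ^ q - U ^ q) :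
    X ^ N ∣ W - U := by
  rw [← Commute.geom_sum₂_mul (Commute.all W U)] at h
  refine (IsUnit.dvd_mul_left ?_).mp h
  rw [isUnit_iff_constantCoeff]
  simp [hW, hU, hq]

open PowerSeries in
theorem exists_symm_of_pow_eq {p q : ℕ} (hq : q ≠ 0) {A B U r : PowerSeries ℂ}
    (hA : constantCoeff A = 1) (hU : constantCoeff U = 1)
    (h1 : U ^ q = A + X ^ (p + q) * r) (h2 : U ^ p * B.subst (X * U⁻¹) = 1) :
    ∃ V r' : PowerSeries ℂ, constantCoeff V = 1 ∧ V ^ p = B + X ^ (p + q) * r' ∧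
      V ^ q * A.subst (X * V⁻¹) = 1 := by
  obtain ⟨W, hW, rfl⟩ := exists_pow_eq_of_constantCoeff_eq_one hA hq
  have hW0 : constantCoeff W ≠ 0 := by simp [hW]
  have hU0 : constantCoeff U ≠ 0 := by simp [hU]
  have hWU : X ^ (p + q) ∣ W - U :=
    X_pow_dvd_sub_of_dvd_pow_sub_pow hW hU hq ⟨-r, by rw [h1]; ring⟩
  have hWU' : X ^ (p + q) ∣ W⁻¹ - U⁻¹ := by
    have : W⁻¹ - U⁻¹ = (W - U) * (-(W⁻¹ * U⁻¹)) := by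
      linear_combination U⁻¹ * PowerSeries.mul_inv_cancel W hW0
        - W⁻¹ * PowerSeries.mul_inv_cancel U hU0
    rw [this]
    exact hWU.mul_right _
  set s : PowerSeries ℂ := X * W⁻¹ with hs
  have hs0 : constantCoeff s = 0 := by simp [hs]
  have hs1 : IsUnit (coeff 1 s) := by simp [hs, coeff_succ_X_mul, hW]
  have hsS := HasSubst.of_constantCoeff_zero' hs0
  set s' := s.substInvOfIsUnit hs1
  have hs'0 : constantCoeff s' = 0 := constantCoeff_substInvOfIsUnit s hs1
  have hs'S := HasSubst.of_constantCoeff_zero' hs'0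
  have hss' : s.subst s' = X := subst_substInvOfIsUnit_right s hs0 hs1
  have hs's : s'.subst s = X := subst_substInvOfIsUnit_left s hs0 hs1
  have hsW : s * W = X := by
    rw [hs, mul_assoc, PowerSeries.inv_mul_cancel W hW0, mul_one]
  have hXW : X * W.subst s' = s' := by
    have h := subst_mul hs'S s W
    rwa [hsW, hss', subst_X hs'S, eq_comm] at h
  have hWs : constantCoeff (W.subst s') = 1 := by
    rw [← coeff_zero_eq_constantCoeff_apply, coeff_subst_eq_sum_range hs'0 _ le_rfl]
    simp [hW]
  have hWs0 : constantCoeff (W.subst s') ≠ 0 := by simp [hWs]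
  obtain ⟨V, hV⟩ : ∃ V : PowerSeries ℂ, V = (W.subst s' : PowerSeries ℂ)⁻¹ := ⟨_, rfl⟩
  have hV1 : constantCoeff V = 1 := by simp [hV, hWs]
  have hVinv : V⁻¹ = W.subst s' := by
    rw [PowerSeries.inv_eq_iff_mul_eq_one (by simp [hV1]), hV,
      PowerSeries.mul_inv_cancel _ hWs0]
  have hVW : V * W.subst s' = 1 := hV ▸ PowerSeries.inv_mul_cancel _ hWs0
  have hVs : V.subst s = W⁻¹ := by
    have h := congrArg (PowerSeries.subst s) hVW
    rw [subst_mul hsS, subst_comp_subst_apply hs'S hsS, hs's, X_subst,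
      ← coe_substAlgHom hsS, map_one, coe_substAlgHom hsS] at h
    exact ((PowerSeries.eq_inv_iff_mul_eq_one hW0).mpr h)
  have hBU : B.subst (X * U⁻¹) = U⁻¹ ^ p := by
    have : U⁻¹ ^ p * U ^ p = 1 := by
      rw [← mul_pow, PowerSeries.inv_mul_cancel U hU0, one_pow]
    linear_combination (-B.subst (X * U⁻¹)) * this + U⁻¹ ^ p * h2
  have hdvd : X ^ (p + q) ∣ (V ^ p - B).subst s := by
    rw [subst_sub hsS, subst_pow hsS, hVs]
    have e1 : X ^ (p + q) ∣ W⁻¹ ^ p - U⁻¹ ^ p := hWU'.trans (sub_dvd_pow_sub_pow _ _ _)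
    have e2 : X ^ (p + q) ∣ B.subst s - B.subst (X * U⁻¹) := by
      refine X_pow_dvd_subst_sub_subst hs0 (by simp) B ?_
      rw [hs, ← mul_sub]
      exact hWU'.mul_left _
    rw [hBU] at e2
    have := dvd_sub e1 e2
    rwa [sub_sub_sub_cancel_right] at this
  obtain ⟨c, hc⟩ := hdvd
  have hfin : V ^ p - B = X ^ (p + q) * ((W.subst s') ^ (p + q) * c.subst s') := by
    have h := congrArg (PowerSeries.subst s') hc
    rw [subst_comp_subst_apply hsS hs'S, hss', X_subst, subst_mul hs'S, subst_pow hs'S,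
      subst_X hs'S, ← hXW, mul_pow, hXW, mul_assoc] at h
    exact h
  refine ⟨V, _, hV1, by rw [← hfin]; ring, ?_⟩
  rw [hVinv, hXW, subst_pow hs'S, ← mul_pow, hVW, one_pow]

theorem constantCoeff_onePlusP (c : ℕ → ℂ) : PowerSeries.constantCoeff (onePlusP c) = 1 := by
  rw [← PowerSeries.coeff_zero_eq_constantCoeff_apply]
  simp [onePlusP, -PowerSeries.coeff_zero_eq_constantCoeff]

theorem onePlusP_coeff {V : PowerSeries ℂ} (hV : PowerSeries.constantCoeff V = 1) :
    onePlusP (fun n => PowerSeries.coeff n V) = V := by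
  ext n
  by_cases hn : n = 0
  · subst hn
    simp [onePlusP, hV]
  · simp [onePlusP, hn]

theorem zz_ne_zero : zz ≠ 0 := by simp [zz]

theorem zz_mul_ofPowerSeries_X : zz * HahnSeries.ofPowerSeries ℤ ℂ PowerSeries.X = 1 := by
  rw [HahnSeries.ofPowerSeries_X, zz, HahnSeries.single_mul_single]
  simp

theorem coeff_zz_pow_mul (N : ℕ) (x : LS) (k : ℤ) :
    (zz ^ N * x).coeff k = x.coeff (k + N) := by
  rw [zz, HahnSeries.single_pow, HahnSeries.coeff_single_mul]
  simp

theorem zSeries_zpow (y : ℕ → ℂ) (N n : ℕ) :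
    zSeries y ^ (-((n : ℤ) - N)) = zz ^ N * HahnSeries.ofPowerSeries ℤ ℂ
      (onePlusP y ^ N * (PowerSeries.X * (onePlusP y)⁻¹) ^ n) := by
  have hU : onePlusP y * (onePlusP y)⁻¹ = 1 :=
    PowerSeries.mul_inv_cancel _ (by simp [constantCoeff_onePlusP])
  have hinv : zSeries y *
      HahnSeries.ofPowerSeries ℤ ℂ (PowerSeries.X * (onePlusP y)⁻¹) = 1 := by
    rw [zSeries, onePlusL, map_mul, mul_mul_mul_comm, zz_mul_ofPowerSeries_X, ← map_mul, hU,
      map_one, one_mul]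
  have h0 : zSeries y ≠ 0 := left_ne_zero_of_mul_eq_one hinv
  rw [neg_sub, zpow_sub₀ h0, zpow_natCast, zpow_natCast, div_eq_mul_inv, ← inv_pow,
    ← eq_inv_of_mul_eq_one_right hinv, map_mul _ (_ ^ N), map_pow, map_pow, ← mul_assoc, ← mul_pow]
  rfl

/-- Composition with `zSeries y`, expressed by substitution of power series in `1/v`. -/
theorem compEq_iff (N : ℕ) (f : PowerSeries ℂ) (y : ℕ → ℂ) (H : LS) :
    CompEq (zz ^ N * HahnSeries.ofPowerSeries ℤ ℂ f) (zSeries y) H ↔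
      H = zz ^ N * HahnSeries.ofPowerSeries ℤ ℂ
        (onePlusP y ^ N * f.subst (PowerSeries.X * (onePlusP y)⁻¹)) := by
  rw [HahnSeries.ext_iff, funext_iff]
  refine forall_congr' fun k => ?_
  suffices h : ∑ᶠ m : ℤ, (zz ^ N * HahnSeries.ofPowerSeries ℤ ℂ f).coeff m *
      (zSeries y ^ (-m)).coeff k = (zz ^ N * HahnSeries.ofPowerSeries ℤ ℂ
        (onePlusP y ^ N * f.subst (PowerSeries.X * (onePlusP y)⁻¹))).coeff k by rw [h]
  have hinj : Function.Injective fun n : ℕ => (n : ℤ) - N := fun a b h => by simpa using h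
  have hsupp : (Function.support fun m : ℤ => (zz ^ N * HahnSeries.ofPowerSeries ℤ ℂ f).coeff m *
      (zSeries y ^ (-m)).coeff k) ⊆ Set.range fun n : ℕ => (n : ℤ) - N := by
    intro m hm
    by_contra hr
    apply hm
    have hneg : m + N < 0 := by
      by_contra! h
      exact hr ⟨(m + N).toNat, by simp [Int.toNat_of_nonneg h]⟩
    simp only
    rw [coeff_zz_pow_mul, PowerSeries.coeff_coe, if_pos hneg, zero_mul]
  rw [← finsum_mem_univ, finsum_mem_inter_support_eq _ _ (Set.range fun n : ℕ => (n : ℤ) - N)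
    (by rw [Set.univ_inter, Set.inter_eq_right.mpr hsupp]), finsum_mem_range hinj]
  simp only [zSeries_zpow, coeff_zz_pow_mul, sub_add_cancel, HahnSeries.ofPowerSeries_apply_coeff]
  by_cases hk : k + N < 0
  · simp only [PowerSeries.coeff_coe, if_pos hk, mul_zero, finsum_zero]
  · obtain ⟨j, hj⟩ := Int.eq_ofNat_of_zero_le (not_lt.mp hk)
    rw [hj]
    simp only [HahnSeries.ofPowerSeries_apply_coeff]
    exact (coeff_mul_subst_eq_finsum (by simp) _ _ _).symm

theorem GaugeAt.exists_eq {p q : ℕ} {R : LS} (hR : GaugeAt p R) :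
    ∃ r : PowerSeries ℂ, R = zz ^ q * HahnSeries.ofPowerSeries ℤ ℂ (PowerSeries.X ^ (p + q) * r) := by
  refine ⟨PowerSeries.mk fun n => R.coeff (n + p), ?_⟩
  ext k
  rw [coeff_zz_pow_mul]
  by_cases hk : k + q < 0
  · rw [PowerSeries.coeff_coe, if_pos hk, hR k (by omega)]
  · obtain ⟨j, hj⟩ := Int.eq_ofNat_of_zero_le (not_lt.mp hk)
    rw [hj, HahnSeries.ofPowerSeries_apply_coeff, PowerSeries.coeff_X_pow_mul']
    split_ifs with h
    · rw [PowerSeries.coeff_mk]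
      congr 1
      push_cast [Nat.cast_sub h]
      omega
    · exact hR k (by omega)

theorem gaugeAt_zz_pow_mul (p q : ℕ) (r : PowerSeries ℂ) :
    GaugeAt q (zz ^ p * HahnSeries.ofPowerSeries ℤ ℂ (PowerSeries.X ^ (p + q) * r)) := by
  intro k hk
  rw [coeff_zz_pow_mul, PowerSeries.coeff_coe]
  split_ifs with h
  · rfl
  · rw [PowerSeries.coeff_X_pow_mul', if_neg (by omega)]

theorem statement13 (p q : ℕ) (hp : 1 ≤ p) (hq : 1 ≤ q) (a ah : ℕ → ℂ)
    (h : ∃ (R : LS) (y : ℕ → ℂ), GaugeAt p R ∧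
      zSeries y ^ q = zz ^ q * onePlusL a + R ∧
      CompEq (zz ^ p * onePlusL ah) (zSeries y) (zz ^ p)) :
    ∃ (R' : LS) (y' : ℕ → ℂ), GaugeAt q R' ∧
      zSeries y' ^ p = zz ^ p * onePlusL ah + R' ∧
      CompEq (zz ^ q * onePlusL a) (zSeries y') (zz ^ q) := by
  obtain ⟨R, y, hR, hY, hc⟩ := h
  obtain ⟨r, rfl⟩ := hR.exists_eq (q := q)
  rw [onePlusL, compEq_iff, left_eq_mul₀ (pow_ne_zero _ zz_ne_zero), ← map_one (HahnSeries.ofPowerSeries ℤ ℂ),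
    HahnSeries.ofPowerSeries_injective.eq_iff] at hc
  rw [zSeries, onePlusL, onePlusL, mul_pow, ← mul_add, ← map_pow, ← map_add,
    mul_right_inj' (pow_ne_zero _ zz_ne_zero), HahnSeries.ofPowerSeries_injective.eq_iff] at hY
  obtain ⟨V, r', hV, h1, h2⟩ := exists_symm_of_pow_eq (by omega) (constantCoeff_onePlusP a)
    (constantCoeff_onePlusP y) hY hc
  refine ⟨_, fun n => PowerSeries.coeff n V, gaugeAt_zz_pow_mul p q r', ?_, ?_⟩
  · rw [zSeries, onePlusL, onePlusL, onePlusP_coeff hV, mul_pow, ← mul_add, ← map_pow, ← map_add, h1]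
  · rw [onePlusL, compEq_iff, onePlusP_coeff hV, h2, map_one, mul_one]
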